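/- arXiv:1810.01669 — 7 statements merged into one kernel-verified Lean document; each statement's English description precedes it below -/
import Mathlib

section
/- Let p > 0 and p' > 1 be real numbers with p - p' + 1 > 0. Then there exists a constant C = C(p,p') > 0, depending only on p and p', such that for all k > 0 and all x > 0, ∫₀ˣ u^(p-p') / (1 + k·u^p) du ≤ C · x^(p-p'+1) / (1 + x^(p-p'+1) · k^((p-p'+1)/p)). -/
open MeasureTheory

section

variable {r p k x : ℝ}

lemma rpow_div_one_add_mul_rpow_le (hk : 0 ≤ k) {u : ℝ} (hu : 0 ≤ u) :
    u ^ r / (1 + k * u ^ p) ≤ u ^ r :=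
  div_le_self (by positivity) (le_add_of_nonneg_right (by positivity))

lemma intervalIntegrable_rpow_div_one_add_mul_rpow (hr : -1 < r) (hk : 0 ≤ k) {a b : ℝ}
    (ha : 0 ≤ a) (hb : 0 ≤ b) :
    IntervalIntegrable (fun u : ℝ ↦ u ^ r / (1 + k * u ^ p)) volume a b := by
  refine (intervalIntegral.intervalIntegrable_rpow' hr).mono_fun'
    (Measurable.aestronglyMeasurable (by fun_prop)) ?_
  filter_upwards [ae_restrict_mem measurableSet_uIoc] with u hu
  have hu0 : 0 ≤ u := (le_min ha hb).trans hu.1.le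
  rw [Real.norm_of_nonneg (by positivity)]
  exact rpow_div_one_add_mul_rpow_le hk hu0

lemma integral_rpow_div_one_add_mul_rpow_le (hr : -1 < r) (hk : 0 ≤ k) (hx : 0 ≤ x) :
    ∫ u in (0 : ℝ)..x, u ^ r / (1 + k * u ^ p) ≤ x ^ (r + 1) / (r + 1) := by
  have h := intervalIntegral.integral_mono_on (μ := volume) hx
    (intervalIntegrable_rpow_div_one_add_mul_rpow (p := p) hr hk le_rfl hx)
    (intervalIntegral.intervalIntegrable_rpow' hr)
    (fun u hu ↦ rpow_div_one_add_mul_rpow_le hk hu.1)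
  rwa [integral_rpow (Or.inl hr), Real.zero_rpow (by linarith), sub_zero] at h

lemma integral_rpow_div_one_add_mul_rpow_tail_le (hr : -1 < r) (hrp : r + 1 < p) (hk : 0 < k)
    {t : ℝ} (ht : 0 < t) (htx : t ≤ x) :
    ∫ u in t..x, u ^ r / (1 + k * u ^ p) ≤ t ^ (r + 1 - p) / (k * (p - (r + 1))) := by
  have hx : 0 < x := ht.trans_le htx
  have hmem : (0 : ℝ) ∉ Set.uIcc t x := Set.notMem_uIcc_of_lt ht hx
  have h := intervalIntegral.integral_mono_on (μ := volume)
    (g := fun u : ℝ ↦ k⁻¹ * u ^ (r - p)) htx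
    (intervalIntegrable_rpow_div_one_add_mul_rpow (p := p) hr hk.le ht.le hx.le)
    ((intervalIntegral.intervalIntegrable_rpow (Or.inr hmem)).const_mul _)
    (fun u hu ↦ by
      have hu0 : 0 < u := ht.trans_le hu.1
      calc u ^ r / (1 + k * u ^ p) ≤ u ^ r / (k * u ^ p) := by
            gcongr
            linarith
        _ = k⁻¹ * u ^ (r - p) := by
            rw [Real.rpow_sub hu0]
            field_simp)
  rw [intervalIntegral.integral_const_mul,
    integral_rpow (Or.inr ⟨by linarith, hmem⟩)] at h
  have hq : 0 < p - (r + 1) := by linarith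
  have hxpos : 0 ≤ x ^ (r + 1 - p) := by positivity
  refine h.trans ?_
  rw [show r - p + 1 = r + 1 - p by ring]
  calc k⁻¹ * ((x ^ (r + 1 - p) - t ^ (r + 1 - p)) / (r + 1 - p))
      = (t ^ (r + 1 - p) - x ^ (r + 1 - p)) / (k * (p - (r + 1))) := by
        rw [← neg_sub p (r + 1), div_neg, ← neg_div, neg_sub, ← div_div,
          div_eq_inv_mul _ k, mul_div_assoc]
    _ ≤ t ^ (r + 1 - p) / (k * (p - (r + 1))) := by
        gcongr
        linarith

lemma integral_rpow_div_one_add_mul_rpow_le_const (hr : -1 < r) (hrp : r + 1 < p) (hk : 0 < k)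
    (hx : 0 ≤ x) :
    ∫ u in (0 : ℝ)..x, u ^ r / (1 + k * u ^ p) ≤
      (1 / (r + 1) + 1 / (p - (r + 1))) / k ^ ((r + 1) / p) := by
  have ha : 0 < r + 1 := by linarith
  have hq : 0 < p - (r + 1) := by linarith
  have hp : 0 < p := by linarith
  set t : ℝ := k ^ (-1 / p) with ht_def
  have ht : 0 < t := by positivity
  have hta : t ^ (r + 1) = 1 / k ^ ((r + 1) / p) := by
    rw [ht_def, ← Real.rpow_mul hk.le, one_div, ← Real.rpow_neg hk.le]
    congr 1
    ring
  have htp : t ^ p = 1 / k := by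
    rw [ht_def, ← Real.rpow_mul hk.le, div_mul_cancel₀ _ hp.ne', Real.rpow_neg_one, one_div]
  have hbound : (1 / (r + 1) + 1 / (p - (r + 1))) / k ^ ((r + 1) / p) =
      t ^ (r + 1) / (r + 1) + t ^ (r + 1 - p) / (k * (p - (r + 1))) := by
    rw [Real.rpow_sub ht, hta, htp]
    field_simp
  rw [hbound]
  have htail : 0 ≤ t ^ (r + 1 - p) / (k * (p - (r + 1))) := by positivity
  rcases le_total x t with hxt | htx
  · calc _ ≤ x ^ (r + 1) / (r + 1) := integral_rpow_div_one_add_mul_rpow_le hr hk.le hx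
      _ ≤ t ^ (r + 1) / (r + 1) := by gcongr
      _ ≤ _ := le_add_of_nonneg_right htail
  · rw [← intervalIntegral.integral_add_adjacent_intervals
      (intervalIntegrable_rpow_div_one_add_mul_rpow hr hk.le le_rfl ht.le)
      (intervalIntegrable_rpow_div_one_add_mul_rpow hr hk.le ht.le hx)]
    exact add_le_add (integral_rpow_div_one_add_mul_rpow_le hr hk.le ht.le)
      (integral_rpow_div_one_add_mul_rpow_tail_le hr hrp hk ht htx)

end

/-- Let `p > 0` and `p' > 1` be real numbers with `p - p' + 1 > 0`. Then there
exists a constant `C = C(p,p') > 0` such that for all `k > 0` and all `x > 0`,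
`∫₀ˣ u^(p-p') / (1 + k·u^p) du ≤ C · x^(p-p'+1) / (1 + x^(p-p'+1) · k^((p-p'+1)/p))`. -/
theorem stmt0 (p p' : ℝ) (hp : 0 < p) (hp' : 1 < p') (hpp' : 0 < p - p' + 1) :
    ∃ C : ℝ, 0 < C ∧ ∀ k : ℝ, 0 < k → ∀ x : ℝ, 0 < x →
      (∫ u in (0:ℝ)..x, u ^ (p - p') / (1 + k * u ^ p))
        ≤ C * x ^ (p - p' + 1) / (1 + x ^ (p - p' + 1) * k ^ ((p - p' + 1) / p)) := by
  have hr : -1 < p - p' := by linarith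
  have hrp : p - p' + 1 < p := by linarith
  have hq : 0 < p - (p - p' + 1) := by linarith
  refine ⟨2 / (p - p' + 1) + 1 / (p - (p - p' + 1)), by positivity, fun k hk x hx ↦ ?_⟩
  have h₁ := integral_rpow_div_one_add_mul_rpow_le (p := p) hr hk.le hx.le
  have h₂ := integral_rpow_div_one_add_mul_rpow_le_const hr hrp hk hx.le
  have hs : 0 < k ^ ((p - p' + 1) / p) := by positivity
  have hy : 0 < x ^ (p - p' + 1) := by positivity
  rw [le_div_iff₀ hs] at h₂
  rw [le_div_iff₀ (by positivity)]
  calc _ = (∫ u in (0 : ℝ)..x, u ^ (p - p') / (1 + k * u ^ p)) +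
        (∫ u in (0 : ℝ)..x, u ^ (p - p') / (1 + k * u ^ p)) * k ^ ((p - p' + 1) / p) *
          x ^ (p - p' + 1) := by ring
    _ ≤ x ^ (p - p' + 1) / (p - p' + 1) +
        (1 / (p - p' + 1) + 1 / (p - (p - p' + 1))) * x ^ (p - p' + 1) := by gcongr
    _ = _ := by ring
end

section
/- Let p > 0 and p' > 1 be real numbers with p - p' + 1 > 0. Then there exists a constant C = C(p,p') > 0, depending only on p and p', such that for all k > 0 and all x > 0, ∫₀ˣ k·u^(p-p') / (1 + k·u^p) du ≤ C · k^((p'-1)/p). -/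
open MeasureTheory

theorem intervalIntegrable_mul_rpow_div_one_add {p r k x : ℝ} (hp : 0 < p) (hr : -1 < r)
    (hk : 0 < k) (hx : 0 ≤ x) :
    IntervalIntegrable (fun u : ℝ => k * u ^ r / (1 + k * u ^ p)) volume 0 x := by
  have hcont : ContinuousOn (fun u : ℝ => k / (1 + k * u ^ p)) (Set.uIcc 0 x) := by
    refine continuousOn_const.div
      (continuous_const.add (continuous_const.mul (Real.continuous_rpow_const hp.le))).continuousOn
      fun u hu => ?_
    rw [Set.uIcc_of_le hx] at hu
    have := Real.rpow_nonneg hu.1 p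
    positivity
  refine ((intervalIntegral.intervalIntegrable_rpow' hr).mul_continuousOn hcont).congr
    fun u _ => ?_
  ring

/-- Let `p > 0` and `p' > 1` be real numbers with `p - p' + 1 > 0`. Then there
exists a constant `C = C(p,p') > 0` such that for all `k > 0` and all `x > 0`,
`∫₀ˣ k·u^(p-p') / (1 + k·u^p) du ≤ C · k^((p'-1)/p)`. -/
theorem stmt1 (p p' : ℝ) (hp : 0 < p) (hp' : 1 < p') (hpp' : 0 < p - p' + 1) :
    ∃ C : ℝ, 0 < C ∧ ∀ k : ℝ, 0 < k → ∀ x : ℝ, 0 < x →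
      (∫ u in (0:ℝ)..x, k * u ^ (p - p') / (1 + k * u ^ p)) ≤ C * k ^ ((p' - 1) / p) := by
  have hp1 : 0 < p' - 1 := by linarith
  refine ⟨1 / (p - p' + 1) + 1 / (p' - 1), by positivity, fun k hk x hx => ?_⟩
  set f : ℝ → ℝ := fun u => k * u ^ (p - p') / (1 + k * u ^ p) with hf
  set c : ℝ := k ^ (-1 / p) with hc
  have hc0 : 0 < c := Real.rpow_pos_of_pos hk _
  set y := max x c
  have hxy : x ≤ y := le_max_left _ _
  have hcy : c ≤ y := le_max_right _ _
  have hy0 : 0 < y := hx.trans_le hxy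
  have hint : ∀ z : ℝ, 0 ≤ z → IntervalIntegrable f volume 0 z := fun z hz =>
    intervalIntegrable_mul_rpow_div_one_add hp (by linarith) hk hz
  have hnonneg : ∀ u : ℝ, 0 ≤ u → 0 ≤ f u := fun u hu => by
    have := Real.rpow_nonneg hu p
    have := Real.rpow_nonneg hu (p - p')
    simp only [hf]
    positivity
  have hcy_int : IntervalIntegrable f volume c y := (hint c hc0.le).symm.trans (hint y hy0.le)
  have h0 : (0 : ℝ) ∉ Set.uIcc c y := by
    rw [Set.uIcc_of_le hcy]
    exact fun h => hc0.not_ge h.1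
  have hmono : ∫ u in (0:ℝ)..x, f u ≤ ∫ u in (0:ℝ)..y, f u := by
    rw [← intervalIntegral.integral_add_adjacent_intervals (hint x hx.le)
      ((hint x hx.le).symm.trans (hint y hy0.le))]
    exact le_add_of_nonneg_right
      (intervalIntegral.integral_nonneg hxy fun u hu => hnonneg u (hx.le.trans hu.1))
  have hsmall : ∫ u in (0:ℝ)..c, f u ≤ 1 / (p - p' + 1) * k ^ ((p' - 1) / p) := by
    have hle : ∫ u in (0:ℝ)..c, f u ≤ ∫ u in (0:ℝ)..c, k * u ^ (p - p') := by
      refine intervalIntegral.integral_mono_on hc0.le (hint c hc0.le)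
        ((intervalIntegral.intervalIntegrable_rpow' (by linarith)).const_mul k) fun u hu => ?_
      have := Real.rpow_nonneg hu.1 p
      have := Real.rpow_nonneg hu.1 (p - p')
      exact div_le_self (by positivity) (le_add_of_nonneg_right (by positivity))
    have hkc : k * c ^ (p - p' + 1) = k ^ ((p' - 1) / p) := by
      rw [hc, ← Real.rpow_mul hk.le, ← Real.rpow_one_add' hk.le]
      · congr 1
        field_simp
        ring
      · have : 1 + -1 / p * (p - p' + 1) = (p' - 1) / p := by
          field_simp
          ring
        rw [this]
        positivity
    rw [intervalIntegral.integral_const_mul, integral_rpow (Or.inl (by linarith)),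
      Real.zero_rpow hpp'.ne', sub_zero, ← mul_div_assoc, hkc] at hle
    exact hle.trans_eq (by ring)
  have hlarge : ∫ u in c..y, f u ≤ 1 / (p' - 1) * k ^ ((p' - 1) / p) := by
    have hle : ∫ u in c..y, f u ≤ ∫ u in c..y, u ^ (-p') := by
      refine intervalIntegral.integral_mono_on hcy hcy_int
        (intervalIntegral.intervalIntegrable_rpow (Or.inr h0)) fun u hu => ?_
      have hu0 : 0 < u := hc0.trans_le hu.1
      have h1 := Real.rpow_pos_of_pos hu0 p
      have h2 := Real.rpow_pos_of_pos hu0 (-p')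
      simp only [hf]
      rw [div_le_iff₀ (by positivity), sub_eq_add_neg, Real.rpow_add hu0]
      nlinarith
    have hck : c ^ (-p' + 1) = k ^ ((p' - 1) / p) := by
      rw [hc, ← Real.rpow_mul hk.le]
      congr 1
      field_simp
      ring
    rw [integral_rpow (Or.inr ⟨by linarith, h0⟩), hck] at hle
    have hy := Real.rpow_pos_of_pos hy0 (-p' + 1)
    refine hle.trans ?_
    rw [← neg_div_neg_eq, show -(-p' + 1) = p' - 1 by ring, one_div_mul_eq_div]
    gcongr
    linarith
  calc ∫ u in (0:ℝ)..x, f u ≤ ∫ u in (0:ℝ)..y, f u := hmono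
    _ = (∫ u in (0:ℝ)..c, f u) + ∫ u in c..y, f u :=
      (intervalIntegral.integral_add_adjacent_intervals (hint c hc0.le) hcy_int).symm
    _ ≤ _ := by
      rw [add_mul]
      exact add_le_add hsmall hlarge
end

section
/- Let p > 0 and p' > 1 be real numbers with p - p' + 1 > 0. Then for every x > 0, ∫₀ˣ u^(p-p') / (1 + u^p) du ≤ (p / ((p-p'+1)(p'-1))) · min(x^(p-p'+1), 1). -/
open MeasureTheory

lemma rpow_div_one_add_rpow_le (r p : ℝ) {u : ℝ} (hu : 0 ≤ u) :
    u ^ r / (1 + u ^ p) ≤ u ^ r :=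
  div_le_self (Real.rpow_nonneg hu r) (by linarith [Real.rpow_nonneg hu p])

lemma rpow_sub_div_one_add_rpow_le (p q : ℝ) {u : ℝ} (hu : 0 < u) :
    u ^ (p - q) / (1 + u ^ p) ≤ u ^ (-q) := by
  have hp := Real.rpow_pos_of_pos hu p
  have hq := Real.rpow_pos_of_pos hu (-q)
  rw [div_le_iff₀ (by linarith), sub_eq_add_neg, Real.rpow_add hu]
  nlinarith

lemma intervalIntegrable_rpow_div_one_add_rpow {r : ℝ} (p : ℝ) (hr : -1 < r) {a b : ℝ}
    (ha : 0 ≤ a) (hb : 0 ≤ b) :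
    IntervalIntegrable (fun u : ℝ => u ^ r / (1 + u ^ p)) volume a b := by
  refine (intervalIntegral.intervalIntegrable_rpow' hr).mono_fun'
    (Measurable.aestronglyMeasurable (by fun_prop)) ?_
  filter_upwards [ae_restrict_mem measurableSet_uIoc] with u hu
  have hu0 : 0 ≤ u := (le_min ha hb).trans hu.1.le
  have h := Real.rpow_nonneg hu0 p
  rw [Real.norm_of_nonneg (div_nonneg (Real.rpow_nonneg hu0 r) (by linarith))]
  exact rpow_div_one_add_rpow_le r p hu0

lemma integral_rpow_div_one_add_rpow_le {r : ℝ} (p : ℝ) (hr : -1 < r) {x : ℝ} (hx : 0 ≤ x) :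
    (∫ u in (0:ℝ)..x, u ^ r / (1 + u ^ p)) ≤ x ^ (r + 1) / (r + 1) := by
  calc (∫ u in (0:ℝ)..x, u ^ r / (1 + u ^ p)) ≤ ∫ u in (0:ℝ)..x, u ^ r :=
        intervalIntegral.integral_mono_on hx
          (intervalIntegrable_rpow_div_one_add_rpow p hr le_rfl hx)
          (intervalIntegral.intervalIntegrable_rpow' hr)
          fun u hu => rpow_div_one_add_rpow_le r p hu.1
    _ = x ^ (r + 1) / (r + 1) := by
        rw [integral_rpow (Or.inl hr), Real.zero_rpow (by linarith), sub_zero]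

lemma integral_one_rpow_sub_div_one_add_rpow_le {p q : ℝ} (hq : 1 < q) (hpq : -1 < p - q)
    {x : ℝ} (hx : 1 ≤ x) :
    (∫ u in (1:ℝ)..x, u ^ (p - q) / (1 + u ^ p)) ≤ 1 / (q - 1) := by
  have h0 : (0:ℝ) ∉ Set.uIcc 1 x := by
    rw [Set.uIcc_of_le hx]
    exact fun h => absurd h.1 (by norm_num)
  calc (∫ u in (1:ℝ)..x, u ^ (p - q) / (1 + u ^ p)) ≤ ∫ u in (1:ℝ)..x, u ^ (-q) :=
        intervalIntegral.integral_mono_on hx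
          (intervalIntegrable_rpow_div_one_add_rpow p hpq zero_le_one (by linarith))
          (intervalIntegral.intervalIntegrable_rpow (Or.inr h0))
          fun u hu => rpow_sub_div_one_add_rpow_le p q (by linarith [hu.1])
    _ = (1 - x ^ (-q + 1)) / (q - 1) := by
        rw [integral_rpow (Or.inr ⟨by linarith, h0⟩), Real.one_rpow, ← neg_div_neg_eq]
        ring_nf
    _ ≤ 1 / (q - 1) := by
        have := Real.rpow_nonneg (zero_le_one.trans hx) (-q + 1)
        exact div_le_div_of_nonneg_right (by linarith) (by linarith)

/-- Let `p > 0` and `p' > 1` be real numbers with `p - p' + 1 > 0`. Then for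
every `x > 0`, `∫₀ˣ u^(p-p') / (1 + u^p) du ≤ (p / ((p-p'+1)(p'-1))) · min (x^(p-p'+1)) 1`. -/
theorem stmt2 (p p' : ℝ) (hp : 0 < p) (hp' : 1 < p') (hpp' : 0 < p - p' + 1) :
    ∀ x : ℝ, 0 < x →
      (∫ u in (0:ℝ)..x, u ^ (p - p') / (1 + u ^ p))
        ≤ p / ((p - p' + 1) * (p' - 1)) * min (x ^ (p - p' + 1)) 1 := by
  intro x hx
  have hr : -1 < p - p' := by linarith
  have hb : 0 < p' - 1 := by linarith
  have hconst : p / ((p - p' + 1) * (p' - 1)) = 1 / (p - p' + 1) + 1 / (p' - 1) := by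
    field_simp
    ring
  rw [hconst]
  rcases le_total x 1 with h1 | h1
  · rw [min_eq_left (Real.rpow_le_one hx.le h1 hpp'.le)]
    refine (integral_rpow_div_one_add_rpow_le p hr hx.le).trans ?_
    have : 0 ≤ 1 / (p' - 1) * x ^ (p - p' + 1) := by positivity
    rw [add_mul, one_div_mul_eq_div]
    linarith
  · rw [min_eq_right (Real.one_le_rpow h1 hpp'.le), mul_one,
      ← intervalIntegral.integral_add_adjacent_intervals
        (intervalIntegrable_rpow_div_one_add_rpow p hr le_rfl zero_le_one)
        (intervalIntegrable_rpow_div_one_add_rpow p hr zero_le_one hx.le)]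
    have h := integral_rpow_div_one_add_rpow_le p hr zero_le_one
    rw [Real.one_rpow] at h
    exact add_le_add h (integral_one_rpow_sub_div_one_add_rpow_le hp' hr h1)
end

section
/- Let 0 < α < 1 and 0 < β ≤ 1 with α + β > 1, let s < t be real numbers, and let g : [s,t] → ℝ^d satisfy |g(u) - g(v)| ≤ L |u - v|^β for all u, v ∈ [s,t], where L ≥ 0. Then for every r ∈ (s,t), |g(r) - g(t)| / (t - r)^(1-α) + (1-α) · ∫_r^t |g(r) - g(u)| / (u - r)^(2-α) du ≤ (1 + (1-α)/(α+β-1)) · L · (t - r)^(α+β-1). (This gives the bound |D_{t-}^{1-α} g_{t-}(r)| ≤ C L (t-r)^(α+β-1) for the right-sided Weyl fractional derivative of order 1-α of g_{t-}(·) = g(·) - g(t), up to the factor 1/Γ(α).) -/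
open MeasureTheory

/-- The integral of the shifted power `(u - a) ^ p` over `[a, b]`, for `p > -1`. -/
theorem integral_sub_rpow {a b p : ℝ} (hp : -1 < p) :
    ∫ u in a..b, (u - a) ^ p = (b - a) ^ (p + 1) / (p + 1) := by
  rw [intervalIntegral.integral_comp_sub_right (fun x : ℝ => x ^ p) a,
    integral_rpow (Or.inl hp), sub_self, Real.zero_rpow (by linarith), sub_zero]

theorem intervalIntegrable_sub_rpow {a b p : ℝ} (hp : -1 < p) :
    IntervalIntegrable (fun u : ℝ => (u - a) ^ p) volume a b := by
  simpa using (intervalIntegral.intervalIntegrable_rpow' (a := 0) (b := b - a) hp).comp_sub_right a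

/-- Let `0 < α < 1`, `0 < β ≤ 1` with `α + β > 1`, let `s < t` and let
`g : [s,t] → ℝ^d` be `β`-Hölder with constant `L`.  Then for every `r ∈ (s,t)`,
`‖g r - g t‖/(t-r)^(1-α) + (1-α) ∫_r^t ‖g r - g u‖/(u-r)^(2-α) du
  ≤ (1 + (1-α)/(α+β-1)) · L · (t-r)^(α+β-1)`. -/
theorem stmt4 (d : ℕ) (α β : ℝ) (hα0 : 0 < α) (hα1 : α < 1) (hβ0 : 0 < β) (hβ1 : β ≤ 1)
    (hαβ : 1 < α + β) (s t : ℝ) (hst : s < t) (L : ℝ) (hL : 0 ≤ L)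
    (g : ℝ → EuclideanSpace ℝ (Fin d))
    (hg : ∀ u ∈ Set.Icc s t, ∀ v ∈ Set.Icc s t, ‖g u - g v‖ ≤ L * |u - v| ^ β) :
    ∀ r ∈ Set.Ioo s t,
      ‖g r - g t‖ / (t - r) ^ (1 - α)
          + (1 - α) * ∫ u in r..t, ‖g r - g u‖ / (u - r) ^ (2 - α)
        ≤ (1 + (1 - α) / (α + β - 1)) * L * (t - r) ^ (α + β - 1) := by
  rintro r ⟨hsr, hrt⟩
  have key : ∀ γ : ℝ, ∀ u ∈ Set.Ioc r t,
      ‖g r - g u‖ / (u - r) ^ γ ≤ L * (u - r) ^ (β - γ) := by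
    rintro γ u ⟨hru, hut⟩
    have hpos : 0 < u - r := sub_pos.2 hru
    have h := hg r ⟨hsr.le, hrt.le⟩ u ⟨(hsr.trans hru).le, hut⟩
    rw [abs_sub_comm, abs_of_pos hpos] at h
    rw [Real.rpow_sub hpos, ← mul_div_assoc]
    gcongr
  have hp : -1 < β - (2 - α) := by linarith
  have hfirst := key (1 - α) t ⟨hrt, le_rfl⟩
  have hint : ∫ u in r..t, ‖g r - g u‖ / (u - r) ^ (2 - α)
      ≤ L * ((t - r) ^ (α + β - 1) / (α + β - 1)) := by
    calc ∫ u in r..t, ‖g r - g u‖ / (u - r) ^ (2 - α)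
        ≤ ‖∫ u in r..t, ‖g r - g u‖ / (u - r) ^ (2 - α)‖ := Real.le_norm_self _
      _ ≤ ∫ u in r..t, L * (u - r) ^ (β - (2 - α)) := by
          refine intervalIntegral.norm_integral_le_of_norm_le hrt.le
            (Filter.Eventually.of_forall fun u hu => ?_)
            ((intervalIntegrable_sub_rpow hp).const_mul L)
          rw [Real.norm_of_nonneg
            (div_nonneg (norm_nonneg _) (Real.rpow_nonneg (sub_pos.2 hu.1).le _))]
          exact key (2 - α) u hu
      _ = L * ((t - r) ^ (α + β - 1) / (α + β - 1)) := by
          rw [intervalIntegral.integral_const_mul, integral_sub_rpow hp,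
            show β - (2 - α) + 1 = α + β - 1 by ring]
  rw [show β - (1 - α) = α + β - 1 by ring] at hfirst
  calc _ ≤ L * (t - r) ^ (α + β - 1)
        + (1 - α) * (L * ((t - r) ^ (α + β - 1) / (α + β - 1))) :=
        add_le_add hfirst (mul_le_mul_of_nonneg_left hint (sub_pos.2 hα1).le)
    _ = _ := by ring
end

section
/- Let 1/2 < H < 1 and define, for 0 < s < t, the kernel K_H(t,s) = (s^(1/2-H) / Γ(H - 1/2)) · ∫_s^t r^(H-1/2) (r - s)^(H-3/2) dr, where Γ is the Euler Gamma function. Then for every T > 0 and every ε ∈ (0, T], ∫_{T-ε}^T K_H(T,s)² ds ≥ ε^(2H) / (2H · ((H - 1/2) · Γ(H - 1/2))²). -/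
open MeasureTheory

lemma intervalIntegrable_sub_rpow_s6 {b : ℝ} (hb : -1 < b) (s t : ℝ) :
    IntervalIntegrable (fun r : ℝ => (r - s) ^ b) volume s t := by
  simpa using (intervalIntegral.intervalIntegrable_rpow' hb (a := 0) (b := t - s)).comp_sub_right s

lemma integral_sub_rpow_s6 {a : ℝ} (ha : 0 < a) (s t : ℝ) :
    ∫ r in s..t, (r - s) ^ (a - 1) = (t - s) ^ a / a := by
  rw [intervalIntegral.integral_comp_sub_right (fun x : ℝ => x ^ (a - 1)) s,
    integral_rpow (Or.inl (by linarith))]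
  simp [Real.zero_rpow ha.ne']

lemma intervalIntegrable_rpow_mul_sub_rpow {a : ℝ} (ha : 0 < a) (s t : ℝ) :
    IntervalIntegrable (fun r : ℝ => r ^ a * (r - s) ^ (a - 1)) volume s t :=
  (intervalIntegrable_sub_rpow_s6 (by linarith) s t).continuousOn_mul
    (Real.continuous_rpow_const ha.le).continuousOn

lemma le_integral_rpow_mul_sub_rpow {a s t : ℝ} (ha : 0 < a) (hs : 0 ≤ s) (hst : s ≤ t) :
    s ^ a * ((t - s) ^ a / a) ≤ ∫ r in s..t, r ^ a * (r - s) ^ (a - 1) := by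
  rw [← integral_sub_rpow_s6 ha, ← intervalIntegral.integral_const_mul]
  refine intervalIntegral.integral_mono_on hst
    ((intervalIntegrable_sub_rpow_s6 (by linarith) s t).const_mul _)
    (intervalIntegrable_rpow_mul_sub_rpow ha s t) fun r hr => ?_
  exact mul_le_mul_of_nonneg_right (Real.rpow_le_rpow hs hr.1 ha.le)
    (Real.rpow_nonneg (sub_nonneg.2 hr.1) _)

lemma integral_rpow_mul_sub_rpow_le {a s t : ℝ} (ha : 0 < a) (hs : 0 ≤ s) (hst : s ≤ t) :
    ∫ r in s..t, r ^ a * (r - s) ^ (a - 1) ≤ t ^ a * ((t - s) ^ a / a) := by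
  rw [← integral_sub_rpow_s6 ha, ← intervalIntegral.integral_const_mul]
  refine intervalIntegral.integral_mono_on hst
    (intervalIntegrable_rpow_mul_sub_rpow ha s t)
    ((intervalIntegrable_sub_rpow_s6 (by linarith) s t).const_mul _) fun r hr => ?_
  exact mul_le_mul_of_nonneg_right (Real.rpow_le_rpow (hs.trans hr.1) hr.2 ha.le)
    (Real.rpow_nonneg (sub_nonneg.2 hr.1) _)

lemma stronglyMeasurable_intervalIntegral_left {f : ℝ × ℝ → ℝ} (hf : Measurable f) (t : ℝ) :
    StronglyMeasurable fun s : ℝ => ∫ r in s..t, f (s, r) := by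
  have h1 : MeasurableSet {p : ℝ × ℝ | p.2 ∈ Set.Ioc p.1 t} :=
    (measurableSet_lt measurable_fst measurable_snd).inter
      (measurableSet_le measurable_snd measurable_const)
  have h2 : MeasurableSet {p : ℝ × ℝ | p.2 ∈ Set.Ioc t p.1} :=
    (measurableSet_lt measurable_const measurable_snd).inter
      (measurableSet_le measurable_snd measurable_fst)
  have key := ((hf.indicator h1).stronglyMeasurable.integral_prod_right' (ν := volume)).sub
    ((hf.indicator h2).stronglyMeasurable.integral_prod_right' (ν := volume))
  convert key using 1
  ext s
  rw [intervalIntegral, ← integral_indicator measurableSet_Ioc,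
    ← integral_indicator measurableSet_Ioc]
  rfl

/-- The Volterra kernel of fractional Brownian motion with Hurst parameter `a + 1 / 2`. -/
noncomputable def volterraKernel (a t s : ℝ) : ℝ :=
  s ^ (-a) / Real.Gamma a * ∫ r in s..t, r ^ a * (r - s) ^ (a - 1)

lemma le_volterraKernel {a s t : ℝ} (ha : 0 < a) (hs : 0 < s) (hst : s ≤ t) :
    (t - s) ^ a / (a * Real.Gamma a) ≤ volterraKernel a t s := by
  have hΓ := Real.Gamma_pos_of_pos ha
  calc (t - s) ^ a / (a * Real.Gamma a)
      = s ^ (-a) / Real.Gamma a * (s ^ a * ((t - s) ^ a / a)) := by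
        have := (Real.rpow_pos_of_pos hs a).ne'
        rw [Real.rpow_neg hs.le]
        field_simp
    _ ≤ volterraKernel a t s :=
        mul_le_mul_of_nonneg_left (le_integral_rpow_mul_sub_rpow ha hs.le hst) (by positivity)

lemma volterraKernel_le {a s t : ℝ} (ha : 0 < a) (hs : 0 < s) (hst : s ≤ t) :
    volterraKernel a t s ≤ t ^ a * (t ^ a / a) / Real.Gamma a * s ^ (-a) := by
  have hΓ := Real.Gamma_pos_of_pos ha
  have ht : 0 < t := hs.trans_le hst
  calc volterraKernel a t s
      ≤ s ^ (-a) / Real.Gamma a * (t ^ a * ((t - s) ^ a / a)) :=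
        mul_le_mul_of_nonneg_left (integral_rpow_mul_sub_rpow_le ha hs.le hst) (by positivity)
    _ ≤ s ^ (-a) / Real.Gamma a * (t ^ a * (t ^ a / a)) := by
        have : (t - s) ^ a ≤ t ^ a :=
          Real.rpow_le_rpow (sub_nonneg.2 hst) (by linarith) ha.le
        gcongr
    _ = t ^ a * (t ^ a / a) / Real.Gamma a * s ^ (-a) := by ring

lemma measurable_volterraKernel (a t : ℝ) : Measurable (volterraKernel a t) := by
  have h : Measurable fun p : ℝ × ℝ => p.2 ^ a * (p.2 - p.1) ^ (a - 1) := by fun_prop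
  have := (stronglyMeasurable_intervalIntegral_left h t).measurable
  unfold volterraKernel
  fun_prop

lemma intervalIntegrable_volterraKernel_sq {a t u : ℝ} (ha : 0 < a) (ha' : a < 1 / 2)
    (hu : 0 ≤ u) (hut : u ≤ t) :
    IntervalIntegrable (fun s => volterraKernel a t s ^ 2) volume u t := by
  refine ((intervalIntegral.intervalIntegrable_rpow' (r := -a * 2) (by linarith)).const_mul
    ((t ^ a * (t ^ a / a) / Real.Gamma a) ^ 2)).mono_fun'
    ((measurable_volterraKernel a t).pow_const 2).aestronglyMeasurable ?_
  filter_upwards [ae_restrict_mem measurableSet_uIoc] with s hs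
  rw [Set.uIoc_of_le hut] at hs
  have hs0 : 0 < s := hu.trans_lt hs.1
  have hΓ := Real.Gamma_pos_of_pos ha
  have hK : 0 ≤ volterraKernel a t s :=
    (div_nonneg (Real.rpow_nonneg (sub_nonneg.2 hs.2) _) (by positivity)).trans
      (le_volterraKernel ha hs0 hs.2)
  rw [Real.norm_of_nonneg (sq_nonneg _), Real.rpow_mul hs0.le, Real.rpow_two, ← mul_pow]
  exact pow_le_pow_left₀ hK (volterraKernel_le ha hs0 hs.2) 2

lemma le_integral_volterraKernel_sq {a t u : ℝ} (ha : 0 < a) (ha' : a < 1 / 2)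
    (hu : 0 ≤ u) (hut : u ≤ t) :
    (t - u) ^ (2 * a + 1) / ((2 * a + 1) * (a * Real.Gamma a) ^ 2)
      ≤ ∫ s in u..t, volterraKernel a t s ^ 2 := by
  have hΓ := Real.Gamma_pos_of_pos ha
  have hI : ∫ s in u..t, (t - s) ^ (2 * a) / (a * Real.Gamma a) ^ 2
      = (t - u) ^ (2 * a + 1) / ((2 * a + 1) * (a * Real.Gamma a) ^ 2) := by
    rw [intervalIntegral.integral_div,
      intervalIntegral.integral_comp_sub_left (fun x : ℝ => x ^ (2 * a)) t,
      integral_rpow (Or.inl (by linarith)), sub_self, Real.zero_rpow (by linarith), sub_zero,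
      div_div]
  rw [← hI]
  refine intervalIntegral.integral_mono_on_of_le_Ioo hut
    (Continuous.intervalIntegrable (((Real.continuous_rpow_const (by linarith)).comp
      (continuous_const.sub continuous_id)).div_const _) _ _)
    (intervalIntegrable_volterraKernel_sq ha ha' hu hut) fun s hs => ?_
  have h0 : 0 ≤ t - s := sub_nonneg.2 hs.2.le
  rw [mul_comm 2 a, Real.rpow_mul h0, Real.rpow_two, ← div_pow]
  exact pow_le_pow_left₀ (by positivity) (le_volterraKernel ha (hu.trans_lt hs.1) hs.2.le) 2

/-- Let `1/2 < H < 1` and let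
`K_H(t,s) = (s^(1/2-H)/Γ(H-1/2)) ∫_s^t r^(H-1/2)(r-s)^(H-3/2) dr` be the Volterra kernel of
fractional Brownian motion.  Then for every `T > 0` and every `ε ∈ (0,T]`,
`∫_{T-ε}^T K_H(T,s)² ds ≥ ε^(2H) / (2H ((H-1/2) Γ(H-1/2))²)`. -/
theorem stmt6 (H : ℝ) (hH1 : 1 / 2 < H) (hH2 : H < 1) (T : ℝ) (hT : 0 < T)
    (ε : ℝ) (hε : ε ∈ Set.Ioc 0 T) :
    ε ^ (2 * H) / (2 * H * ((H - 1 / 2) * Real.Gamma (H - 1 / 2)) ^ 2)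
      ≤ ∫ s in (T - ε)..T,
          (s ^ (1 / 2 - H) / Real.Gamma (H - 1 / 2)
            * ∫ r in s..T, r ^ (H - 1 / 2) * (r - s) ^ (H - 3 / 2)) ^ 2 := by
  have h := le_integral_volterraKernel_sq (a := H - 1 / 2) (t := T) (u := T - ε)
    (by linarith) (by linarith) (by linarith [hε.2]) (by linarith [hε.1])
  simp only [volterraKernel] at h
  rwa [sub_sub_cancel, show 2 * (H - 1 / 2) + 1 = 2 * H by ring, neg_sub,
    show H - 1 / 2 - 1 = H - 3 / 2 by ring] at h
end

section
/- Let 1/2 < H < 1 and θ > H - 1/2. Then there exists a constant C = C(H, θ) > 0 such that for all s > 0 and all k ≥ 0, ∫₀^s (k · (s - r)^(θ - 1/2 - H) · r^(1/2-H)) / (1 + k · (s - r)^θ) dr ≤ C · (s^(1-2H) + s^(1/2-H) · k^((H - 1/2)/θ)). -/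
open MeasureTheory

/-- A function dominating `k u^(θ-1-a) / (1 + k u^θ)` on `u > 0`, obtained by keeping the larger
term of the denominator on each side of the threshold `k^(-1/θ)`. -/
noncomputable def kernelMajorant (a θ k u : ℝ) : ℝ :=
  (Set.Ioc 0 (k ^ (-1 / θ))).indicator (fun u => k * u ^ (θ - 1 - a)) u +
    (Set.Ioi (k ^ (-1 / θ))).indicator (fun u => u ^ (-1 - a)) u

lemma kernelMajorant_nonneg {k : ℝ} (a θ u : ℝ) (hk : 0 ≤ k) :
    0 ≤ kernelMajorant a θ k u := by
  have hu₀ : 0 ≤ k ^ (-1 / θ) := Real.rpow_nonneg hk _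
  refine add_nonneg (Set.indicator_nonneg (fun x hx => ?_) _)
    (Set.indicator_nonneg (fun x hx => ?_) _)
  · exact mul_nonneg hk (Real.rpow_nonneg hx.1.le _)
  · exact Real.rpow_nonneg (hu₀.trans (le_of_lt hx)) _

lemma kernel_le_rpow {a θ k u : ℝ} (hk : 0 ≤ k) (hu : 0 < u) :
    k * u ^ (θ - 1 - a) / (1 + k * u ^ θ) ≤ u ^ (-1 - a) := by
  have hθu : 0 ≤ k * u ^ θ := mul_nonneg hk (Real.rpow_nonneg hu.le _)
  have hsplit : u ^ (θ - 1 - a) = u ^ θ * u ^ (-1 - a) := by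
    rw [← Real.rpow_add hu]; ring_nf
  rw [div_le_iff₀ (by linarith), hsplit]
  nlinarith [Real.rpow_nonneg hu.le (-1 - a)]

lemma kernel_le_kernelMajorant {a θ k u : ℝ} (hk : 0 ≤ k) (hu : 0 < u) :
    k * u ^ (θ - 1 - a) / (1 + k * u ^ θ) ≤ kernelMajorant a θ k u := by
  have hθu : 0 ≤ k * u ^ θ := mul_nonneg hk (Real.rpow_nonneg hu.le _)
  unfold kernelMajorant
  rcases le_or_gt u (k ^ (-1 / θ)) with h | h
  · rw [Set.indicator_of_mem (Set.mem_Ioc.2 ⟨hu, h⟩),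
      Set.indicator_of_notMem (by simpa using h), add_zero]
    exact div_le_self (mul_nonneg hk (Real.rpow_nonneg hu.le _)) (by linarith)
  · rw [Set.indicator_of_notMem (by simp [h]), Set.indicator_of_mem (Set.mem_Ioi.2 h), zero_add]
    exact kernel_le_rpow hk hu

lemma integrableOn_Ioc_rpow {b c : ℝ} (hb : -1 < b) (hc : 0 ≤ c) :
    IntegrableOn (fun u : ℝ => u ^ b) (Set.Ioc 0 c) :=
  (intervalIntegrable_iff_integrableOn_Ioc_of_le hc).1
    (intervalIntegral.intervalIntegrable_rpow' hb)

lemma integrable_kernelMajorant {a θ k : ℝ} (ha : 0 < a) (hθ : a < θ) (hk : 0 < k) :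
    Integrable (kernelMajorant a θ k) := by
  have hu₀ : 0 < k ^ (-1 / θ) := Real.rpow_pos_of_pos hk _
  refine Integrable.add ?_ ?_
  · rw [integrable_indicator_iff measurableSet_Ioc]
    exact (integrableOn_Ioc_rpow (by linarith) hu₀.le).const_mul k
  · rw [integrable_indicator_iff measurableSet_Ioi]
    exact integrableOn_Ioi_rpow_of_lt (by linarith) hu₀

lemma integral_kernelMajorant {a θ k : ℝ} (ha : 0 < a) (hθ : a < θ) (hk : 0 < k) :
    ∫ u, kernelMajorant a θ k u = (1 / (θ - a) + 1 / a) * k ^ (a / θ) := by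
  have hu₀ : 0 < k ^ (-1 / θ) := Real.rpow_pos_of_pos hk _
  have hθ₀ : θ ≠ 0 := (ha.trans hθ).ne'
  have hθa : θ - a ≠ 0 := by linarith
  have hint₁ : Integrable
      ((Set.Ioc 0 (k ^ (-1 / θ))).indicator (fun u => k * u ^ (θ - 1 - a))) := by
    rw [integrable_indicator_iff measurableSet_Ioc]
    exact (integrableOn_Ioc_rpow (by linarith) hu₀.le).const_mul k
  have hint₂ : Integrable ((Set.Ioi (k ^ (-1 / θ))).indicator (fun u : ℝ => u ^ (-1 - a))) := by
    rw [integrable_indicator_iff measurableSet_Ioi]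
    exact integrableOn_Ioi_rpow_of_lt (by linarith) hu₀
  unfold kernelMajorant
  rw [integral_add hint₁ hint₂, integral_indicator measurableSet_Ioc,
    integral_indicator measurableSet_Ioi, integral_Ioi_rpow_of_lt (by linarith) hu₀,
    ← intervalIntegral.integral_of_le hu₀.le, intervalIntegral.integral_const_mul,
    integral_rpow (Or.inl (by linarith)), Real.zero_rpow (by linarith),
    ← Real.rpow_mul hk.le, ← Real.rpow_mul hk.le]
  have h₁ : k * k ^ (-1 / θ * (θ - 1 - a + 1)) = k ^ (a / θ) := by
    nth_rewrite 1 [← Real.rpow_one k]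
    rw [← Real.rpow_add hk]
    congr 1
    field_simp
    ring
  have h₂ : -1 / θ * (-1 - a + 1) = a / θ := by ring
  have h₃ : θ - 1 - a + 1 = θ - a := by ring
  have h₄ : -1 - a + 1 = -a := by ring
  rw [h₂, sub_zero, ← mul_div_assoc, h₁, h₃, h₄]
  field_simp

lemma integral_kernel_le {a θ s k : ℝ} (ha : 0 < a) (ha1 : a < 1) (hθ : a < θ) (hs : 0 < s)
    (hk : 0 < k) :
    ∫ r in (0:ℝ)..s, k * (s - r) ^ (θ - 1 - a) * r ^ (-a) / (1 + k * (s - r) ^ θ) ≤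
      2 ^ (1 + a) / (1 - a) * s ^ (-2 * a) +
        2 ^ a * (1 / (θ - a) + 1 / a) * (s ^ (-a) * k ^ (a / θ)) := by
  have hs2 : 0 < s / 2 := by linarith
  have hhalf (b : ℝ) : (s / 2) ^ (-b) = 2 ^ b * s ^ (-b) := by
    rw [Real.div_rpow hs.le (by norm_num), Real.rpow_neg (by norm_num : (0:ℝ) ≤ 2), div_inv_eq_mul,
      mul_comm]
  have hint₁ : IntegrableOn (fun r : ℝ => (s / 2) ^ (-1 - a) * r ^ (-a)) (Set.Ioc 0 s) :=
    (integrableOn_Ioc_rpow (by linarith) hs.le).const_mul _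
  have hint₂ : Integrable (fun r => (s / 2) ^ (-a) * kernelMajorant a θ k (s - r)) :=
    ((integrable_kernelMajorant ha hθ hk).comp_sub_left s).const_mul _
  have hpt : ∀ r ∈ Set.Ioo 0 s,
      k * (s - r) ^ (θ - 1 - a) * r ^ (-a) / (1 + k * (s - r) ^ θ) ≤
        (s / 2) ^ (-1 - a) * r ^ (-a) + (s / 2) ^ (-a) * kernelMajorant a θ k (s - r) := by
    rintro r ⟨hr0, hrs⟩
    have hu : 0 < s - r := by linarith
    have hra : 0 ≤ r ^ (-a) := Real.rpow_nonneg hr0.le _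
    have hm := kernelMajorant_nonneg a θ (s - r) hk.le
    rw [mul_div_right_comm]
    rcases le_total r (s / 2) with h | h
    · refine le_add_of_le_of_nonneg ?_ (mul_nonneg (Real.rpow_nonneg hs2.le _) hm)
      refine mul_le_mul_of_nonneg_right ((kernel_le_rpow hk.le hu).trans ?_) hra
      exact Real.rpow_le_rpow_of_nonpos hs2 (by linarith) (by linarith)
    · refine le_add_of_nonneg_of_le (mul_nonneg (Real.rpow_nonneg hs2.le _) hra) ?_
      rw [mul_comm]
      exact mul_le_mul (Real.rpow_le_rpow_of_nonpos hs2 h (by linarith))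
        (kernel_le_kernelMajorant hk.le hu) (by positivity) (Real.rpow_nonneg hs2.le _)
  have hbound₁ : ∫ r in Set.Ioc 0 s, (s / 2) ^ (-1 - a) * r ^ (-a) =
      2 ^ (1 + a) / (1 - a) * s ^ (-2 * a) := by
    rw [← intervalIntegral.integral_of_le hs.le, intervalIntegral.integral_const_mul,
      integral_rpow (Or.inl (by linarith)), Real.zero_rpow (by linarith),
      show -1 - a = -(1 + a) by ring, hhalf,
      show -2 * a = -(1 + a) + (-a + 1) by ring, Real.rpow_add hs (-(1 + a))]
    ring
  have hbound₂ : ∫ r in Set.Ioc 0 s, (s / 2) ^ (-a) * kernelMajorant a θ k (s - r) ≤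
      2 ^ a * (1 / (θ - a) + 1 / a) * (s ^ (-a) * k ^ (a / θ)) := by
    refine (setIntegral_le_integral hint₂ (Filter.Eventually.of_forall fun r =>
      mul_nonneg (Real.rpow_nonneg hs2.le _) (kernelMajorant_nonneg a θ (s - r) hk.le))).trans
      (le_of_eq ?_)
    rw [integral_const_mul, integral_sub_left_eq_self (kernelMajorant a θ k) volume s,
      integral_kernelMajorant ha hθ hk, hhalf]
    ring
  rw [intervalIntegral.integral_of_le hs.le]
  calc _ ≤ ∫ r in Set.Ioc 0 s,
        ((s / 2) ^ (-1 - a) * r ^ (-a) + (s / 2) ^ (-a) * kernelMajorant a θ k (s - r)) := by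
        rw [integral_Ioc_eq_integral_Ioo, integral_Ioc_eq_integral_Ioo]
        refine integral_mono_of_nonneg ?_
          ((hint₁.add hint₂.integrableOn).mono_set Set.Ioo_subset_Ioc_self) ?_
        · filter_upwards [ae_restrict_mem measurableSet_Ioo] with r hr
          have hu : 0 < s - r := sub_pos.2 hr.2
          have hr0 : 0 < r := hr.1
          simp only [Pi.zero_apply]
          positivity
        · filter_upwards [ae_restrict_mem measurableSet_Ioo] with r hr using hpt r hr
    _ ≤ _ := by
        rw [integral_add hint₁ hint₂.integrableOn, hbound₁]
        gcongr

/-- Let `1/2 < H < 1` and `θ > H - 1/2`.  Then there exists a constant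
`C = C(H,θ) > 0` such that for all `s > 0` and all `k ≥ 0`,
`∫₀^s k (s-r)^(θ-1/2-H) r^(1/2-H) / (1 + k (s-r)^θ) dr
  ≤ C (s^(1-2H) + s^(1/2-H) k^((H-1/2)/θ))`. -/
theorem stmt8 (H θ : ℝ) (hH1 : 1 / 2 < H) (hH2 : H < 1) (hθ : H - 1 / 2 < θ) :
    ∃ C : ℝ, 0 < C ∧ ∀ s : ℝ, 0 < s → ∀ k : ℝ, 0 ≤ k →
      (∫ r in (0:ℝ)..s,
          k * (s - r) ^ (θ - 1 / 2 - H) * r ^ (1 / 2 - H) / (1 + k * (s - r) ^ θ))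
        ≤ C * (s ^ (1 - 2 * H) + s ^ (1 / 2 - H) * k ^ ((H - 1 / 2) / θ)) := by
  obtain ⟨a, rfl⟩ : ∃ a, H = a + 1 / 2 := ⟨H - 1 / 2, by ring⟩
  have ha : 0 < a := by linarith
  have ha1 : a < 1 := by linarith
  rw [show a + 1 / 2 - 1 / 2 = a by ring] at *
  rw [show θ - 1 / 2 - (a + 1 / 2) = θ - 1 - a by ring,
    show 1 / 2 - (a + 1 / 2) = -a by ring, show 1 - 2 * (a + 1 / 2) = -2 * a by ring]
  have hc₁ : 0 < (2:ℝ) ^ (1 + a) / (1 - a) := div_pos (by positivity) (by linarith)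
  have hc₂ : 0 < (2:ℝ) ^ a * (1 / (θ - a) + 1 / a) := by
    have : 0 < θ - a := by linarith
    positivity
  refine ⟨2 ^ (1 + a) / (1 - a) + 2 ^ a * (1 / (θ - a) + 1 / a), by positivity,
    fun s hs k hk => ?_⟩
  rcases hk.eq_or_lt with rfl | hk
  · simp only [zero_mul, zero_div, intervalIntegral.integral_zero]
    positivity
  · refine (integral_kernel_le ha ha1 hθ hs hk).trans ?_
    rw [mul_add (_ + _) (s ^ _)]
    gcongr
    · exact le_add_of_nonneg_right hc₂.le
    · exact le_add_of_nonneg_left hc₁.le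
end

section
/- Let μ be a finite (nonnegative) Borel measure on ℝ^d. Suppose there exist α ∈ (0, 1), m ∈ ℕ, s ∈ (α, m) and a constant Kappa > 0 such that for every bounded α-Hölder continuous function φ : ℝ^d → ℝ and every h ∈ ℝ^d with |h| ≤ 1, |∫_{ℝ^d} Δ_h^m φ(x) μ(dx)| ≤ Kappa · |h|^s · (‖φ‖_∞ + [φ]_α), where [φ]_α = sup_{x ≠ y} |φ(x) - φ(y)| / |x - y|^α. Then μ is absolutely continuous with respect to Lebesgue measure on ℝ^d. -/
open MeasureTheory

/-- The `m`-th iterated difference operator: `Δ_h f (x) = f (x + h) - f x` and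
`Δ_h^m f = Δ_h (Δ_h^{m-1} f)`. -/
def deltaPow {E : Type*} [AddCommGroup E] (h : E) (m : ℕ) (f : E → ℝ) : E → ℝ :=
  (fun (g : E → ℝ) (x : E) => g (x + h) - g x)^[m] f

lemma deltaPow_eq_sum {E : Type*} [AddCommGroup E] [Module ℝ E] (h : E) (m : ℕ) (f : E → ℝ) (x : E) :
    deltaPow h m f x =
      ∑ j ∈ Finset.range (m + 1), (-1 : ℝ) ^ (m - j) * m.choose j * f (x + (j : ℝ) • h) := by
  have := fwdDiff_iter_eq_sum_shift h f m x
  rw [show deltaPow h m f x = (fwdDiff h)^[m] f x from rfl, this]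
  refine Finset.sum_congr rfl fun j _ => ?_
  rw [zsmul_eq_mul, Nat.cast_smul_eq_nsmul]
  push_cast
  rfl

section Mollifier

variable {E : Type*} [NormedAddCommGroup E]

/-- The unnormalised tent function `z ↦ (1 - ‖z‖)₊`. -/
noncomputable def tent (z : E) : ℝ := max 0 (1 - ‖z‖)

lemma continuous_tent : Continuous (tent : E → ℝ) := by unfold tent; fun_prop

lemma tent_nonneg (z : E) : 0 ≤ tent z := le_max_left _ _

lemma tent_le_one (z : E) : tent z ≤ 1 := max_le zero_le_one (by linarith [norm_nonneg z])

lemma tent_eq_zero {z : E} (hz : 1 < ‖z‖) : tent z = 0 := max_eq_left (by linarith)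

lemma abs_tent_sub_tent_le (z w : E) : |tent z - tent w| ≤ min 1 ‖z - w‖ := by
  refine le_min ?_ ?_
  · rw [abs_le]
    constructor <;> linarith [tent_nonneg z, tent_le_one z, tent_nonneg w, tent_le_one w]
  · calc |tent z - tent w| ≤ max |(0 : ℝ) - 0| |(1 - ‖z‖) - (1 - ‖w‖)| := abs_max_sub_max_le_max _ _ _ _
      _ ≤ ‖z - w‖ := by
        refine max_le (by simp) ?_
        have := abs_norm_sub_norm_le w z
        rw [norm_sub_rev] at this
        rwa [show 1 - ‖z‖ - (1 - ‖w‖) = ‖w‖ - ‖z‖ by ring]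

variable [NormedSpace ℝ E] [FiniteDimensional ℝ E]

lemma hasCompactSupport_tent : HasCompactSupport (tent : E → ℝ) :=
  HasCompactSupport.intro (isCompact_closedBall (0 : E) 1) fun z hz =>
    tent_eq_zero (by simpa using hz)

variable [MeasurableSpace E] [BorelSpace E] (ρ : Measure E) [ρ.IsAddHaarMeasure]

lemma integrable_tent : Integrable (tent : E → ℝ) ρ :=
  continuous_tent.integrable_of_hasCompactSupport hasCompactSupport_tent

lemma integral_tent_pos : 0 < ∫ z, tent z ∂ρ :=
  continuous_tent.integral_pos_of_hasCompactSupport_nonneg_nonzero hasCompactSupport_tent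
    tent_nonneg (x := (0 : E)) (by simp [tent])

lemma abs_integral_tent_translate_sub_le {g : E → ℝ} {M : ℝ} (hg : Continuous g)
    (hM : ∀ x, |g x| ≤ M) (u v : E) :
    |∫ z, tent z * g (u + z) ∂ρ - ∫ z, tent z * g (v + z) ∂ρ| ≤
      M * (2 * ρ.real (Metric.closedBall 0 1) * min 1 ‖u - v‖) := by
  have hM0 : 0 ≤ M := (abs_nonneg _).trans (hM 0)
  have key : ∀ w : E, ∫ z, tent z * g (w + z) ∂ρ = ∫ z, tent (z - w) * g z ∂ρ := fun w => by
    rw [← integral_sub_right_eq_self (fun z => tent z * g (w + z)) w]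
    simp
  have hint : ∀ w : E, Integrable (fun z => tent (z - w) * g z) ρ := fun w =>
    ((integrable_tent ρ).comp_sub_right w).mul_bdd (c := M) hg.aestronglyMeasurable
      (Filter.Eventually.of_forall hM)
  have hball : ∀ w : E, Integrable ((Metric.closedBall w 1).indicator fun _ => (1 : ℝ)) ρ :=
    fun w => (integrable_indicator_iff Metric.isClosed_closedBall.measurableSet).2
      (integrableOn_const (measure_closedBall_lt_top.ne))
  have hvol : ∀ w : E, ∫ z, (Metric.closedBall w 1).indicator (fun _ => (1 : ℝ)) z ∂ρ
      = ρ.real (Metric.closedBall 0 1) := fun w => by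
    rw [integral_indicator Metric.isClosed_closedBall.measurableSet]
    simp [Measure.real, Measure.addHaar_closedBall_center]
  rw [key, key, ← integral_sub (hint u) (hint v), ← Real.norm_eq_abs]
  have hmin : 0 ≤ min 1 ‖u - v‖ := le_min zero_le_one (norm_nonneg _)
  calc _ ≤ ∫ z, M * min 1 ‖u - v‖ * ((Metric.closedBall u 1).indicator (fun _ => (1 : ℝ)) z
            + (Metric.closedBall v 1).indicator (fun _ => (1 : ℝ)) z) ∂ρ := by
        refine norm_integral_le_of_norm_le (((hball u).add (hball v)).const_mul _) ?_
        refine Filter.Eventually.of_forall fun z => ?_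
        rw [← sub_mul, norm_mul, Real.norm_eq_abs, Real.norm_eq_abs, mul_comm, mul_assoc]
        refine mul_le_mul (hM z) ?_ (abs_nonneg _) hM0
        by_cases hz : z ∈ Metric.closedBall u 1 ∨ z ∈ Metric.closedBall v 1
        · have h1 := abs_tent_sub_tent_le (z - u) (z - v)
          have h2 : ‖z - u - (z - v)‖ = ‖u - v‖ := by
            rw [← norm_neg]; congr 1; abel
          rw [h2] at h1
          refine h1.trans (le_mul_of_one_le_right hmin ?_)
          have h0 : ∀ w : E, 0 ≤ (Metric.closedBall w 1).indicator (fun _ => (1 : ℝ)) z :=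
            fun w => Set.indicator_nonneg (fun _ _ => zero_le_one) _
          rcases hz with hz | hz
          · have := h0 v
            rw [Set.indicator_of_mem hz]; linarith
          · have := h0 u
            rw [Set.indicator_of_mem hz]; linarith
        · push Not at hz
          have h1 : tent (z - u) = 0 := tent_eq_zero (by simpa [dist_eq_norm] using hz.1)
          have h2 : tent (z - v) = 0 := tent_eq_zero (by simpa [dist_eq_norm] using hz.2)
          simp [h1, h2, Set.indicator_of_notMem hz.1, Set.indicator_of_notMem hz.2]
    _ = _ := by
        rw [integral_const_mul, integral_add (hball u) (hball v), hvol, hvol]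
        ring

/-- There is an absolutely continuous probability measure supported in the unit ball whose
translates depend in a Lipschitz way on the translation vector, in total variation. -/
lemma exists_probabilityMeasure_lipschitz_translate :
    ∃ ν : Measure E, IsProbabilityMeasure ν ∧ ν ≪ ρ ∧ (∀ᵐ z ∂ν, ‖z‖ ≤ 1) ∧
      ∃ C : ℝ, 0 ≤ C ∧ ∀ (g : E → ℝ) (M : ℝ), Continuous g → (∀ x, |g x| ≤ M) → ∀ u v : E,
        |∫ z, g (u + z) ∂ν - ∫ z, g (v + z) ∂ν| ≤ M * (C * min 1 ‖u - v‖) := by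
  set I := ∫ z, tent z ∂ρ with hI
  have hI0 : 0 < I := integral_tent_pos ρ
  have hk0 : ∀ z : E, 0 ≤ tent z / I := fun z => div_nonneg (tent_nonneg z) hI0.le
  have hmeas : Measurable fun z : E => ENNReal.ofReal (tent z / I) :=
    (continuous_tent.measurable.div_const I).ennreal_ofReal
  refine ⟨ρ.withDensity fun z => ENNReal.ofReal (tent z / I), ⟨?_⟩,
    withDensity_absolutelyContinuous _ _, ?_, 2 * ρ.real (Metric.closedBall 0 1) / I, by positivity,
    fun g M hg hM u v => ?_⟩
  · rw [withDensity_apply _ MeasurableSet.univ, Measure.restrict_univ,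
      ← ofReal_integral_eq_lintegral_ofReal ((integrable_tent ρ).div_const I)
        (Filter.Eventually.of_forall hk0), integral_div, ← hI, div_self hI0.ne', ENNReal.ofReal_one]
  · rw [ae_withDensity_iff hmeas]
    refine Filter.Eventually.of_forall fun z hz => ?_
    by_contra! h
    exact hz (by simp [tent_eq_zero h])
  · have key : ∀ w : E, ∫ z, g (w + z) ∂ρ.withDensity (fun z => ENNReal.ofReal (tent z / I))
        = (∫ z, tent z * g (w + z) ∂ρ) / I := fun w => by
      rw [integral_withDensity_eq_integral_toReal_smul hmeas (by simp), ← integral_div]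
      refine integral_congr_ae (Filter.Eventually.of_forall fun z => ?_)
      simp only [ENNReal.toReal_ofReal (hk0 z), smul_eq_mul]
      ring
    rw [key, key, ← sub_div, abs_div, abs_of_pos hI0, div_le_iff₀ hI0]
    refine (abs_integral_tent_translate_sub_le ρ hg hM u v).trans_eq ?_
    field_simp

end Mollifier

section Smoothing

set_option linter.unusedSectionVars false

variable {E : Type*} [NormedAddCommGroup E] [NormedSpace ℝ E] [MeasurableSpace E] [BorelSpace E]

/-- The average of `φ` around `x` with respect to `ν` rescaled by `r`. -/
noncomputable def shiftAvg (ν : Measure E) (r : ℝ) (φ : E → ℝ) (x : E) : ℝ :=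
  ∫ z, φ (x + r • z) ∂ν

/-- The combination of the averages of `φ` at the scales `r, 2r, …, mr` for which
`φ - smoothing ν m r φ` is an average of `m`-th differences of `φ`. -/
noncomputable def smoothing (ν : Measure E) (m : ℕ) (r : ℝ) (φ : E → ℝ) (x : E) : ℝ :=
  ∑ j ∈ Finset.Icc 1 m, (-1 : ℝ) ^ (j + 1) * m.choose j * shiftAvg ν (j * r) φ x

lemma integrable_of_continuous_of_abs_le {X : Type*} [TopologicalSpace X] [MeasurableSpace X]
    [OpensMeasurableSpace X] {μ : Measure X} [IsFiniteMeasure μ] {φ : X → ℝ} {M : ℝ}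
    (hφ : Continuous φ) (hM : ∀ x, |φ x| ≤ M) : Integrable φ μ :=
  Integrable.of_bound hφ.measurable.aestronglyMeasurable M (Filter.Eventually.of_forall hM)

variable (ν : Measure E) [IsProbabilityMeasure ν] {φ : E → ℝ} {M : ℝ}

lemma continuous_shiftAvg (r : ℝ) (hφ : Continuous φ) (hM : ∀ x, |φ x| ≤ M) :
    Continuous (shiftAvg ν r φ) :=
  continuous_of_dominated (bound := fun _ => M)
    (fun x => (hφ.comp (by fun_prop : Continuous fun z => x + r • z)).aestronglyMeasurable)
    (fun x => Filter.Eventually.of_forall fun z => hM _) (integrable_const _)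
    (Filter.Eventually.of_forall fun z => hφ.comp (by fun_prop))

lemma abs_shiftAvg_le (r : ℝ) (hM : ∀ x, |φ x| ≤ M) (x : E) : |shiftAvg ν r φ x| ≤ M := by
  simpa [shiftAvg] using norm_integral_le_of_norm_le_const (μ := ν) (f := fun z => φ (x + r • z))
    (Filter.Eventually.of_forall fun z => hM _)

variable [SecondCountableTopology E]

lemma shiftAvg_comm (r t : ℝ) (hφ : Continuous φ) (hM : ∀ x, |φ x| ≤ M) (x : E) :
    shiftAvg ν r (shiftAvg ν t φ) x = shiftAvg ν t (shiftAvg ν r φ) x := by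
  unfold shiftAvg
  rw [integral_integral_swap]
  · simp only [add_right_comm]
  · exact integrable_of_continuous_of_abs_le (hφ.comp (by fun_prop)) fun p => hM _

lemma continuous_smoothing (m : ℕ) (r : ℝ) (hφ : Continuous φ) (hM : ∀ x, |φ x| ≤ M) :
    Continuous (smoothing ν m r φ) :=
  continuous_finsetSum _ fun _ _ => (continuous_shiftAvg ν _ hφ hM).const_mul _

lemma abs_smoothing_le (m : ℕ) (r : ℝ) (hM : ∀ x, |φ x| ≤ M) (x : E) :
    |smoothing ν m r φ x| ≤ (∑ j ∈ Finset.Icc 1 m, (m.choose j : ℝ)) * M := by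
  rw [Finset.sum_mul]
  refine (Finset.abs_sum_le_sum_abs _ _).trans (Finset.sum_le_sum fun j _ => ?_)
  rw [abs_mul, abs_mul, abs_pow, abs_neg, abs_one, one_pow, one_mul, Nat.abs_cast]
  exact mul_le_mul_of_nonneg_left (abs_shiftAvg_le ν _ hM x) (Nat.cast_nonneg _)

lemma shiftAvg_smoothing (m : ℕ) (r t : ℝ) (hφ : Continuous φ) (hM : ∀ x, |φ x| ≤ M) (x : E) :
    shiftAvg ν r (smoothing ν m t φ) x =
      ∑ j ∈ Finset.Icc 1 m,
        (-1 : ℝ) ^ (j + 1) * m.choose j * shiftAvg ν r (shiftAvg ν (j * t) φ) x := by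
  unfold smoothing
  simp only [shiftAvg.eq_def ν r]
  rw [integral_finsetSum]
  · simp only [integral_const_mul]
  · intro j _
    exact (integrable_of_continuous_of_abs_le
      ((continuous_shiftAvg ν (j * t) hφ hM).comp (by fun_prop : Continuous fun z => x + r • z))
      fun z => abs_shiftAvg_le ν (j * t) hM (x + r • z)).const_mul _

lemma smoothing_comm (m : ℕ) (r t : ℝ) (hφ : Continuous φ) (hM : ∀ x, |φ x| ≤ M) :
    smoothing ν m r (smoothing ν m t φ) = smoothing ν m t (smoothing ν m r φ) := by
  funext x
  rw [smoothing, smoothing]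
  simp only [shiftAvg_smoothing ν m _ _ hφ hM, Finset.mul_sum]
  rw [Finset.sum_comm]
  refine Finset.sum_congr rfl fun i _ => Finset.sum_congr rfl fun j _ => ?_
  rw [shiftAvg_comm ν _ _ hφ hM]
  ring

lemma sub_smoothing_eq (m : ℕ) (r : ℝ) (hφ : Continuous φ) (hM : ∀ x, |φ x| ≤ M) (x : E) :
    φ x - smoothing ν m r φ x = (-1) ^ m * ∫ z, deltaPow (r • z) m φ x ∂ν := by
  have hint : ∀ j ∈ Finset.range (m + 1), Integrable
      (fun z => (-1 : ℝ) ^ (m - j) * m.choose j * φ (x + (j : ℝ) • r • z)) ν := fun j _ =>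
    (integrable_of_continuous_of_abs_le
      (hφ.comp (by fun_prop : Continuous fun z => x + (j : ℝ) • r • z)) fun z => hM _).const_mul _
  simp only [deltaPow_eq_sum]
  rw [integral_finsetSum _ hint, Finset.mul_sum, Finset.range_eq_Ico,
    Finset.sum_eq_sum_Ico_succ_bot (Nat.succ_pos m), sub_eq_add_neg]
  congr 1
  · simp [← mul_assoc, ← mul_pow]
  · rw [smoothing, ← Finset.sum_neg_distrib]
    refine Finset.sum_congr (by ext; simp) fun j hj => ?_
    have hjm : j ≤ m := (Finset.mem_Icc.1 hj).2
    have hsign : (-1 : ℝ) ^ m * (-1) ^ (m - j) = (-1) ^ j := by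
      rw [← pow_add, show m + (m - j) = j + 2 * (m - j) by omega, pow_add, pow_mul]
      simp
    rw [integral_const_mul, ← mul_assoc, ← mul_assoc, hsign, shiftAvg, pow_succ]
    simp only [mul_smul]
    ring

variable (μ : Measure E) [IsFiniteMeasure μ]

lemma integral_sub_integral_smoothing_eq (m : ℕ) (r : ℝ) (hφ : Continuous φ)
    (hM : ∀ x, |φ x| ≤ M) :
    ∫ x, φ x ∂μ - ∫ x, smoothing ν m r φ x ∂μ =
      (-1) ^ m * ∫ z, ∫ x, deltaPow (r • z) m φ x ∂μ ∂ν := by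
  rw [← integral_sub (integrable_of_continuous_of_abs_le hφ hM)
    (integrable_of_continuous_of_abs_le (continuous_smoothing ν m r hφ hM)
      (abs_smoothing_le ν m r hM))]
  simp only [sub_smoothing_eq ν m r hφ hM]
  rw [integral_const_mul, integral_integral_swap]
  have : (Function.uncurry fun (x z : E) => deltaPow (r • z) m φ x) = fun p : E × E =>
      ∑ j ∈ Finset.range (m + 1),
        (-1 : ℝ) ^ (m - j) * m.choose j * φ (p.1 + (j : ℝ) • r • p.2) := by
    funext p
    exact deltaPow_eq_sum _ _ _ _
  rw [this]
  exact integrable_finsetSum _ fun j _ => (integrable_of_continuous_of_abs_le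
    (hφ.comp (by fun_prop : Continuous fun p : E × E => p.1 + (j : ℝ) • r • p.2))
    fun p => hM _).const_mul _

lemma abs_integral_sub_integral_smoothing_le {α s K : ℝ} {m : ℕ} (hK : 0 ≤ K) (hs : 0 ≤ s)
    (hν : ∀ᵐ z ∂ν, ‖z‖ ≤ 1)
    (hμ : ∀ (φ : E → ℝ) (Cb Ca : ℝ), (∀ x, |φ x| ≤ Cb) →
      (∀ x y, x ≠ y → |φ x - φ y| ≤ Ca * ‖x - y‖ ^ α) → ∀ h : E, ‖h‖ ≤ 1 →
        |∫ x, deltaPow h m φ x ∂μ| ≤ K * ‖h‖ ^ s * (Cb + Ca))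
    {Ca r : ℝ} (hr0 : 0 ≤ r) (hr1 : r ≤ 1) (hφ : Continuous φ) (hM : ∀ x, |φ x| ≤ M)
    (hCa : 0 ≤ Ca) (hHolder : ∀ x y, |φ x - φ y| ≤ Ca * ‖x - y‖ ^ α) :
    |∫ x, φ x ∂μ - ∫ x, smoothing ν m r φ x ∂μ| ≤ K * r ^ s * (M + Ca) := by
  have hM0 : 0 ≤ M := (abs_nonneg _).trans (hM 0)
  rw [integral_sub_integral_smoothing_eq ν μ m r hφ hM, abs_mul, abs_pow, abs_neg, abs_one, one_pow,
    one_mul]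
  have hbound : ∀ᵐ z ∂ν, ‖∫ x, deltaPow (r • z) m φ x ∂μ‖ ≤ K * r ^ s * (M + Ca) := by
    filter_upwards [hν] with z hz
    have hrz : ‖r • z‖ ≤ r := by
      rw [norm_smul, Real.norm_of_nonneg hr0]
      exact mul_le_of_le_one_right hr0 hz
    refine (hμ φ M Ca hM (fun x y _ => hHolder x y) (r • z) (hrz.trans hr1)).trans ?_
    gcongr
  simpa using norm_integral_le_of_norm_le_const hbound

lemma min_one_le_rpow {t α : ℝ} (ht : 0 ≤ t) (hα0 : 0 ≤ α) (hα1 : α ≤ 1) : min 1 t ≤ t ^ α := by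
  rcases le_total t 1 with h | h
  · refine (min_le_right _ _).trans ?_
    simpa using Real.rpow_le_rpow_of_exponent_ge' ht h hα0 hα1
  · exact (min_le_left _ _).trans (Real.one_le_rpow h hα0)

lemma abs_shiftAvg_sub_le {C α ε r : ℝ} (hC : 0 ≤ C) (hα0 : 0 ≤ α) (hα1 : α ≤ 1)
    (hν : ∀ (g : E → ℝ) (M : ℝ), Continuous g → (∀ x, |g x| ≤ M) → ∀ u v : E,
      |∫ z, g (u + z) ∂ν - ∫ z, g (v + z) ∂ν| ≤ M * (C * min 1 ‖u - v‖))
    (hε : 0 < ε) (hεr : ε ≤ r) (hφ : Continuous φ) (hM : ∀ x, |φ x| ≤ M) (x y : E) :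
    |shiftAvg ν r φ x - shiftAvg ν r φ y| ≤ M * (C * (ε ^ (-α) * ‖x - y‖ ^ α)) := by
  have hM0 : 0 ≤ M := (abs_nonneg _).trans (hM 0)
  have hr : 0 < r := hε.trans_le hεr
  have h := hν (fun u => φ (r • u)) M (hφ.comp (by fun_prop)) (fun u => hM _) (r⁻¹ • x) (r⁻¹ • y)
  simp only [smul_add, smul_inv_smul₀ hr.ne'] at h
  refine h.trans ?_
  gcongr
  calc min 1 ‖r⁻¹ • x - r⁻¹ • y‖ ≤ min 1 (ε⁻¹ * ‖x - y‖) := by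
        rw [← smul_sub, norm_smul, norm_inv, Real.norm_of_nonneg hr.le]
        gcongr
    _ ≤ (ε⁻¹ * ‖x - y‖) ^ α := min_one_le_rpow (by positivity) hα0 hα1
    _ = ε ^ (-α) * ‖x - y‖ ^ α := by
        rw [Real.mul_rpow (by positivity) (norm_nonneg _), Real.inv_rpow hε.le, Real.rpow_neg hε.le]

lemma abs_smoothing_sub_le {C α ε : ℝ} (hC : 0 ≤ C) (hα0 : 0 ≤ α) (hα1 : α ≤ 1)
    (hν : ∀ (g : E → ℝ) (M : ℝ), Continuous g → (∀ x, |g x| ≤ M) → ∀ u v : E,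
      |∫ z, g (u + z) ∂ν - ∫ z, g (v + z) ∂ν| ≤ M * (C * min 1 ‖u - v‖))
    (m : ℕ) (hε : 0 < ε) (hφ : Continuous φ) (hM : ∀ x, |φ x| ≤ M) (x y : E) :
    |smoothing ν m ε φ x - smoothing ν m ε φ y| ≤
      (∑ j ∈ Finset.Icc 1 m, (m.choose j : ℝ)) * M * C * ε ^ (-α) * ‖x - y‖ ^ α := by
  rw [smoothing, smoothing, ← Finset.sum_sub_distrib]
  simp only [Finset.sum_mul]
  refine (Finset.abs_sum_le_sum_abs _ _).trans (Finset.sum_le_sum fun j hj => ?_)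
  rw [← mul_sub, abs_mul, abs_mul, abs_pow, abs_neg, abs_one, one_pow, one_mul, Nat.abs_cast]
  simp only [mul_assoc]
  refine mul_le_mul_of_nonneg_left ?_ (Nat.cast_nonneg _)
  have hj1 : (1 : ℝ) ≤ j := by exact_mod_cast (Finset.mem_Icc.1 hj).1
  exact abs_shiftAvg_sub_le ν hC hα0 hα1 hν hε (le_mul_of_one_le_left hε.le hj1) hφ hM x y

/-- The integrals against `μ` of the smoothings at scales `2⁻ⁿ` converge at a geometric rate,
uniformly over continuous functions with a given sup-norm bound. -/
lemma exists_abs_integral_sub_integral_smoothing_le {α s K : ℝ} {m : ℕ} (hK : 0 ≤ K)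
    (hα0 : 0 ≤ α) (hα1 : α ≤ 1) (hαs : α < s) {C : ℝ} (hC : 0 ≤ C)
    (hν1 : ∀ᵐ z ∂ν, ‖z‖ ≤ 1)
    (hν : ∀ (g : E → ℝ) (M : ℝ), Continuous g → (∀ x, |g x| ≤ M) → ∀ u v : E,
      |∫ z, g (u + z) ∂ν - ∫ z, g (v + z) ∂ν| ≤ M * (C * min 1 ‖u - v‖))
    (hμ : ∀ (φ : E → ℝ) (Cb Ca : ℝ), (∀ x, |φ x| ≤ Cb) →
      (∀ x y, x ≠ y → |φ x - φ y| ≤ Ca * ‖x - y‖ ^ α) → ∀ h : E, ‖h‖ ≤ 1 →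
        |∫ x, deltaPow h m φ x ∂μ| ≤ K * ‖h‖ ^ s * (Cb + Ca)) :
    ∃ D q : ℝ, 0 ≤ q ∧ q < 1 ∧ ∀ (φ : E → ℝ) (M Ca : ℝ), Continuous φ → (∀ x, |φ x| ≤ M) →
      0 ≤ Ca → (∀ x y, |φ x - φ y| ≤ Ca * ‖x - y‖ ^ α) → ∀ n : ℕ,
        |∫ x, smoothing ν m ((1 / 2) ^ n) φ x ∂μ - ∫ x, φ x ∂μ| ≤ D * M * q ^ n := by
  set B : ℝ := ∑ j ∈ Finset.Icc 1 m, (m.choose j : ℝ) with hB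
  have hB0 : 0 ≤ B := Finset.sum_nonneg fun _ _ => Nat.cast_nonneg _
  have hs0 : 0 < s := hα0.trans_lt hαs
  set q : ℝ := (1 / 2) ^ (s - α) with hq
  have hq0 : 0 < q := by positivity
  have hq1 : q < 1 := Real.rpow_lt_one (by norm_num) (by norm_num) (sub_pos.2 hαs)
  set D₀ : ℝ := K * (B * (1 + C)) * ((1 / 2) ^ (-α) + 1) with hD₀
  refine ⟨D₀ / (1 - q), q, hq0.le, hq1, fun φ M Ca hφ hM hCa hHolder n => ?_⟩
  have hM0 : 0 ≤ M := (abs_nonneg _).trans (hM 0)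
  set I : ℕ → ℝ := fun n => ∫ x, smoothing ν m ((1 / 2) ^ n) φ x ∂μ with hI
  have hr0 : ∀ n : ℕ, (0 : ℝ) < (1 / 2) ^ n := fun n => by positivity
  have hr1 : ∀ n : ℕ, (1 / 2 : ℝ) ^ n ≤ 1 := fun n => pow_le_one₀ (by norm_num) (by norm_num)
  have hmix : ∀ r t : ℝ, 0 ≤ r → r ≤ 1 → 0 < t → t ≤ 1 →
      |∫ x, smoothing ν m t φ x ∂μ - ∫ x, smoothing ν m r (smoothing ν m t φ) x ∂μ| ≤
        K * (B * (1 + C)) * M * (r ^ s * t ^ (-α)) := fun r t hr hr1 ht ht1 => by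
    have ht2 : 1 ≤ t ^ (-α) := Real.one_le_rpow_of_pos_of_le_one_of_nonpos ht ht1 (by linarith)
    refine (abs_integral_sub_integral_smoothing_le ν μ hK hs0.le hν1 hμ hr hr1
      (continuous_smoothing ν m t hφ hM) (abs_smoothing_le ν m t hM) (by positivity)
      (abs_smoothing_sub_le ν hC hα0 hα1 hν m ht hφ hM)).trans ?_
    calc K * r ^ s * (B * M + B * M * C * t ^ (-α))
        ≤ K * r ^ s * (B * M * t ^ (-α) + B * M * C * t ^ (-α)) := by
          gcongr K * r ^ s * (?_ + _)
          exact le_mul_of_one_le_right (by positivity) ht2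
      _ = _ := by ring
  have hgeom : ∀ n : ℕ, ((1 / 2 : ℝ) ^ n) ^ s * ((1 / 2 : ℝ) ^ n) ^ (-α) = q ^ n := fun n => by
    rw [← Real.rpow_add (hr0 n), ← sub_eq_add_neg, hq, Real.rpow_pow_comm (by norm_num)]
  have hstep : ∀ n, dist (I n) (I (n + 1)) ≤ D₀ * M * q ^ n := fun n => by
    have h1 := hmix _ _ (hr0 n).le (hr1 n) (hr0 (n + 1)) (hr1 (n + 1))
    have h2 := hmix _ _ (hr0 (n + 1)).le (hr1 (n + 1)) (hr0 n) (hr1 n)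
    rw [smoothing_comm ν m _ _ hφ hM] at h1
    have e1 : ((1 / 2 : ℝ) ^ n) ^ s * ((1 / 2 : ℝ) ^ (n + 1)) ^ (-α) =
        (1 / 2 : ℝ) ^ (-α) * q ^ n := by
      rw [pow_succ, Real.mul_rpow (hr0 n).le (by norm_num), ← mul_assoc, hgeom, mul_comm]
    have e2 : ((1 / 2 : ℝ) ^ (n + 1)) ^ s * ((1 / 2 : ℝ) ^ n) ^ (-α) ≤ q ^ n := by
      rw [← hgeom n]
      gcongr ?_ ^ s * _
      exact pow_le_pow_of_le_one (by norm_num) (by norm_num) n.le_succ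
    rw [e1] at h1
    have h3 : K * (B * (1 + C)) * M * (((1 / 2 : ℝ) ^ (n + 1)) ^ s * ((1 / 2 : ℝ) ^ n) ^ (-α)) ≤
        K * (B * (1 + C)) * M * q ^ n := by gcongr
    rw [Real.dist_eq]
    calc |I n - I (n + 1)| ≤ _ + _ := abs_sub_le _
          (∫ x, smoothing ν m ((1 / 2) ^ (n + 1)) (smoothing ν m ((1 / 2) ^ n) φ) x ∂μ) _
      _ ≤ K * (B * (1 + C)) * M * q ^ n +
            K * (B * (1 + C)) * M * ((1 / 2 : ℝ) ^ (-α) * q ^ n) :=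
          add_le_add (h2.trans h3) (by rwa [abs_sub_comm])
      _ = _ := by rw [hD₀]; ring
  have hlim : Filter.Tendsto I Filter.atTop (nhds (∫ x, φ x ∂μ)) := by
    rw [tendsto_iff_dist_tendsto_zero]
    have hz : Filter.Tendsto (fun n : ℕ => K * ((1 / 2 : ℝ) ^ n) ^ s * (M + Ca)) Filter.atTop
        (nhds 0) := by
      have h0 := (tendsto_pow_atTop_nhds_zero_of_lt_one (r := (1 / 2 : ℝ)) (by norm_num)
        (by norm_num)).rpow_const (p := s) (Or.inr hs0.le)
      rw [Real.zero_rpow hs0.ne'] at h0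
      simpa using (h0.const_mul K).mul_const (M + Ca)
    refine squeeze_zero (fun _ => dist_nonneg) (fun n => ?_) hz
    rw [dist_comm, Real.dist_eq]
    exact abs_integral_sub_integral_smoothing_le ν μ hK hs0.le hν1 hμ (hr0 n).le (hr1 n) hφ hM hCa
      hHolder
  have := dist_le_of_le_geometric_of_tendsto q (D₀ * M) hq1 hstep hlim n
  rw [Real.dist_eq] at this
  exact this.trans_eq (by ring)

lemma tendsto_integral_smoothing_zero [FiniteDimensional ℝ E] (ρ : Measure E)
    [ρ.IsAddHaarMeasure] (hνρ : ν ≪ ρ) {F : Set E} (hF : ρ F = 0) {ψ : ℕ → E → ℝ}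
    (hψ : ∀ k, Continuous (ψ k)) (hM : ∀ k x, |ψ k x| ≤ M)
    (hlim : ∀ x ∉ F, Filter.Tendsto (fun k => ψ k x) Filter.atTop (nhds 0))
    (m : ℕ) {r : ℝ} (hr : 0 < r) :
    Filter.Tendsto (fun k => ∫ x, smoothing ν m r (ψ k) x ∂μ) Filter.atTop (nhds 0) := by
  have hshift : ∀ t : ℝ, 0 < t → ∀ x,
      Filter.Tendsto (fun k => shiftAvg ν t (ψ k) x) Filter.atTop (nhds 0) := fun t ht x => by
    have hnull : ∀ᵐ z ∂ν, x + t • z ∉ F := by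
      suffices ∀ᵐ z ∂ρ, x + t • z ∉ F from hνρ.ae_le this
      rw [ae_iff]
      have : {z | ¬ x + t • z ∉ F} = (fun z => t • z) ⁻¹' ((fun z => x + z) ⁻¹' F) := by
        ext z; simp
      rw [this, Measure.addHaar_preimage_smul ρ ht.ne', measure_preimage_add, hF, mul_zero]
    have := tendsto_integral_of_dominated_convergence (μ := ν)
      (F := fun k z => ψ k (x + t • z)) (f := fun _ => 0) (fun _ => M)
      (fun k => ((hψ k).comp (by fun_prop : Continuous fun z => x + t • z)).aestronglyMeasurable)
      (integrable_const _) (fun k => Filter.Eventually.of_forall fun z => hM k _)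
      (hnull.mono fun z hz => hlim _ hz)
    simpa [shiftAvg] using this
  have hsmooth : ∀ x,
      Filter.Tendsto (fun k => smoothing ν m r (ψ k) x) Filter.atTop (nhds 0) := fun x => by
    have := tendsto_finsetSum (Finset.Icc 1 m) fun j hj =>
      (hshift (j * r) (mul_pos (by exact_mod_cast (Finset.mem_Icc.1 hj).1) hr) x).const_mul
        ((-1 : ℝ) ^ (j + 1) * m.choose j)
    simpa [smoothing] using this
  have := tendsto_integral_of_dominated_convergence (μ := μ)
    (F := fun k => smoothing ν m r (ψ k)) (f := fun _ => 0) _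
    (fun k => (continuous_smoothing ν m r (hψ k) (hM k)).aestronglyMeasurable)
    (integrable_const _) (fun k => Filter.Eventually.of_forall (abs_smoothing_le ν m r (hM k)))
    (Filter.Eventually.of_forall hsmooth)
  simpa using this

end Smoothing

lemma exists_holder_thickenedIndicator {E : Type*} [NormedAddCommGroup E] {α δ : ℝ} (hα0 : 0 ≤ α)
    (hα1 : α ≤ 1) (hδ : 0 < δ) (F : Set E) :
    ∃ L : ℝ, 0 ≤ L ∧ ∀ x y, |(thickenedIndicator hδ F x : ℝ) - thickenedIndicator hδ F y| ≤
      L * ‖x - y‖ ^ α := by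
  refine ⟨max 1 δ⁻¹, by positivity, fun x y => ?_⟩
  have h1 : |(thickenedIndicator hδ F x : ℝ) - thickenedIndicator hδ F y| ≤ 1 := by
    have hx : (thickenedIndicator hδ F x : ℝ) ≤ 1 := by
      exact_mod_cast thickenedIndicator_le_one hδ F x
    have hy : (thickenedIndicator hδ F y : ℝ) ≤ 1 := by
      exact_mod_cast thickenedIndicator_le_one hδ F y
    rw [abs_le]
    constructor <;> linarith [(thickenedIndicator hδ F x).coe_nonneg,
      (thickenedIndicator hδ F y).coe_nonneg]
  have h2 : |(thickenedIndicator hδ F x : ℝ) - thickenedIndicator hδ F y| ≤ δ⁻¹ * ‖x - y‖ := by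
    have := (lipschitzWith_thickenedIndicator hδ F).dist_le_mul x y
    rwa [NNReal.dist_eq, dist_eq_norm, NNReal.coe_inv, Real.coe_toNNReal _ hδ.le] at this
  calc _ ≤ max 1 δ⁻¹ * min 1 ‖x - y‖ := by
        rcases min_choice 1 ‖x - y‖ with h | h <;> rw [h]
        · exact h1.trans (by simp)
        · exact h2.trans (by gcongr; exact le_max_right _ _)
    _ ≤ _ := by
        gcongr
        exact min_one_le_rpow (norm_nonneg _) hα0 hα1

/-- Let `μ` be a finite Borel measure on `ℝ^d`.  Suppose there exist
`α ∈ (0,1)`, `m ∈ ℕ`, `s ∈ (α, m)` and `Kappa > 0` such that for every bounded `α`-Hölder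
function `φ : ℝ^d → ℝ` (with sup-norm bound `Cb` and `α`-Hölder seminorm bound `Ca`) and every
`h` with `‖h‖ ≤ 1`,
`|∫ Δ_h^m φ dμ| ≤ Kappa ‖h‖^s (Cb + Ca)`.
Then `μ` is absolutely continuous with respect to Lebesgue measure on `ℝ^d`. -/
theorem stmt12 (d : ℕ) (μ : Measure (EuclideanSpace ℝ (Fin d))) [IsFiniteMeasure μ]
    (α s Kappa : ℝ) (m : ℕ) (hα0 : 0 < α) (hα1 : α < 1) (hαs : α < s) (hsm : s < m)
    (hKappa : 0 < Kappa)
    (hyp : ∀ (φ : EuclideanSpace ℝ (Fin d) → ℝ) (Cb Ca : ℝ),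
      (∀ x, |φ x| ≤ Cb) →
      (∀ x y, x ≠ y → |φ x - φ y| ≤ Ca * ‖x - y‖ ^ α) →
      ∀ h : EuclideanSpace ℝ (Fin d), ‖h‖ ≤ 1 →
        |∫ x, deltaPow h m φ x ∂μ| ≤ Kappa * ‖h‖ ^ s * (Cb + Ca)) :
    μ ≪ volume := by
  obtain ⟨ν, _, hνac, hν1, C, hC, hν⟩ := exists_probabilityMeasure_lipschitz_translate
    (volume : Measure (EuclideanSpace ℝ (Fin d)))
  obtain ⟨D, q, hq0, hq1, hD⟩ := exists_abs_integral_sub_integral_smoothing_le ν μ hKappa.le hα0.le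
    hα1.le hαs hC hν1 hν hyp
  refine Measure.AbsolutelyContinuous.mk fun A hA hA0 => ?_
  by_contra hμA
  obtain ⟨F, hFA, hF, hμF⟩ := hA.exists_lt_isClosed_of_ne_top (measure_ne_top μ A)
    (pos_iff_ne_zero.2 hμA)
  have hF0 : volume F = 0 := measure_mono_null hFA hA0
  have hδ : ∀ k : ℕ, (0 : ℝ) < 1 / (k + 1) := fun k => by positivity
  set ψ : ℕ → EuclideanSpace ℝ (Fin d) → ℝ := fun k x => thickenedIndicator (hδ k) F x with hψ
  have hψc : ∀ k, Continuous (ψ k) := fun k =>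
    NNReal.continuous_coe.comp (thickenedIndicator (hδ k) F).continuous
  have hψ1 : ∀ k x, |ψ k x| ≤ 1 := fun k x => by
    rw [hψ, NNReal.abs_eq]
    exact_mod_cast thickenedIndicator_le_one (hδ k) F x
  have hψlim : ∀ x ∉ F, Filter.Tendsto (fun k => ψ k x) Filter.atTop (nhds 0) := fun x hx => by
    have := tendsto_pi_nhds.1 (thickenedIndicator_tendsto_indicator_closure hδ
      tendsto_one_div_add_atTop_nhds_zero_nat F) x
    rw [hF.closure_eq, Set.indicator_of_notMem hx] at this
    exact NNReal.tendsto_coe.2 this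
  have hle : ∀ k, μ.real F ≤ ∫ x, ψ k x ∂μ := fun k => by
    rw [← integral_indicator_one hF.measurableSet]
    refine integral_mono
      ((integrable_indicator_iff hF.measurableSet).2 (integrable_const _).integrableOn)
      (integrable_of_continuous_of_abs_le (hψc k) (hψ1 k)) fun x => ?_
    by_cases hx : x ∈ F
    · simp only [hψ, Set.indicator_of_mem hx, thickenedIndicator_one (hδ k) F hx]; simp
    · simp [hψ, hx]
  have hbound : ∀ n : ℕ, μ.real F ≤ D * 1 * q ^ n := fun n => by
    have hlim := (tendsto_integral_smoothing_zero ν μ volume hνac hF0 hψc hψ1 hψlim m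
      (r := (1 / 2) ^ n) (by positivity)).add_const (D * 1 * q ^ n)
    rw [zero_add] at hlim
    refine ge_of_tendsto' hlim fun k => ?_
    obtain ⟨L, hL, hHolder⟩ := exists_holder_thickenedIndicator hα0.le hα1.le (hδ k) F
    have := (abs_le.1 (hD (ψ k) 1 L (hψc k) (hψ1 k) hL hHolder n)).1
    linarith [hle k]
  have hzero : μ.real F ≤ 0 := by
    have := (tendsto_pow_atTop_nhds_zero_of_lt_one hq0 hq1).const_mul (D * 1)
    rw [mul_zero] at this
    exact ge_of_tendsto' this hbound
  exact (ENNReal.toReal_pos hμF.ne' (measure_ne_top μ F)).not_ge hzero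
end
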